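/- arXiv:2503.07116 — 2 statements merged into one kernel-verified Lean document; each statement's English description precedes it below -/
import Mathlib

section
/- Let C be a nonempty set of pairs (x, t) with x in a real vector space E and t ∈ (0, ∞), and let X : E → ℝ be a function with X(x) ≥ 0 for all (x, t) ∈ C. Define g(x, t) = X(x)·t and ĝ(x, t, y) = 2·y·√(X(x)) − y²/t. Then: (i) sup over (x,t) ∈ C of g(x,t) equals sup over (x,t) ∈ C, y ∈ ℝ of ĝ(x,t,y); and (ii) a point (x*, t*) ∈ C maximizes g over C if and only if the point (x*, t*, y*) with y* = t*·√(X(x*)) maximizes ĝ over C × ℝ. -/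
/-- At `y = t * √a` the surrogate attains the product `a * t`. -/
theorem quadratic_surrogate_apply_optimal {a t : ℝ} (ha : 0 ≤ a) (ht : 0 < t) :
    2 * (t * Real.sqrt a) * Real.sqrt a - (t * Real.sqrt a) ^ 2 / t = a * t := by
  have hsq := Real.sq_sqrt ha
  field_simp
  linear_combination hsq

/-- The surrogate is bounded above by the product `a * t`. -/
theorem quadratic_surrogate_le {a t : ℝ} (ha : 0 ≤ a) (ht : 0 < t) (y : ℝ) :
    2 * y * Real.sqrt a - y ^ 2 / t ≤ a * t := by
  have hgap : a * t - (2 * y * Real.sqrt a - y ^ 2 / t) = (y - t * Real.sqrt a) ^ 2 / t := by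
    have hsq := Real.sq_sqrt ha
    field_simp
    linear_combination -t ^ 2 * hsq
  have : 0 ≤ (y - t * Real.sqrt a) ^ 2 / t := by positivity
  linarith

/-- Quadratic transform equivalence (Shen–Yu): over a nonempty feasible set `C` of
pairs `(x, t)` with `t > 0` and `X x ≥ 0`, (i) the supremum of the product
`g(x,t) = X(x)·t` equals the supremum of the surrogate
`ĝ(x,t,y) = 2·y·√(X x) − y²/t` over `C × ℝ`, and (ii) `(x*, t*)` maximizes `g`
over `C` iff `(x*, t*, y*)` with `y* = t*·√(X x*)` maximizes `ĝ` over `C × ℝ`. -/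
theorem quadratic_transform_equivalence {E : Type*} [AddCommGroup E] [Module ℝ E]
    (C : Set (E × ℝ)) (hC : C.Nonempty) (X : E → ℝ)
    (ht : ∀ p ∈ C, 0 < p.2) (hX : ∀ p ∈ C, 0 ≤ X p.1) :
    (sSup {z : ℝ | ∃ p ∈ C, z = X p.1 * p.2} =
      sSup {z : ℝ | ∃ p ∈ C, ∃ y : ℝ, z = 2 * y * Real.sqrt (X p.1) - y ^ 2 / p.2}) ∧
    (∀ pstar ∈ C,
      ((∀ p ∈ C, X p.1 * p.2 ≤ X pstar.1 * pstar.2) ↔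
        (∀ p ∈ C, ∀ y : ℝ,
          2 * y * Real.sqrt (X p.1) - y ^ 2 / p.2 ≤
            2 * (pstar.2 * Real.sqrt (X pstar.1)) * Real.sqrt (X pstar.1) -
              (pstar.2 * Real.sqrt (X pstar.1)) ^ 2 / pstar.2))) := by
  refine ⟨csSup_eq_csSup_of_forall_exists_le ?_ ?_, fun q hq => ?_⟩
  · rintro _ ⟨p, hp, rfl⟩
    exact ⟨_, ⟨p, hp, p.2 * Real.sqrt (X p.1), rfl⟩,
      (quadratic_surrogate_apply_optimal (hX p hp) (ht p hp)).ge⟩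
  · rintro _ ⟨p, hp, y, rfl⟩
    exact ⟨_, ⟨p, hp, rfl⟩, quadratic_surrogate_le (hX p hp) (ht p hp) y⟩
  · rw [quadratic_surrogate_apply_optimal (hX q hq) (ht q hq)]
    refine ⟨fun h p hp y => (quadratic_surrogate_le (hX p hp) (ht p hp) y).trans (h p hp),
      fun h p hp => ?_⟩
    exact (quadratic_surrogate_apply_optimal (hX p hp) (ht p hp)).ge.trans (h p hp _)
end

section
/- Let n be a natural number, X : Fin n → ℝ with X i ≥ 0 for all i, t : Fin n → ℝ with t i > 0 for all i, and D ∈ ℝ. Then ∑_i X i · t i ≥ D holds if and only if there exists y : Fin n → ℝ such that ∑_i (2 · y i · √(X i) − (y i)² / t i) ≥ D. -/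
/-- Completing the square: the quadratic transform of `x * t` falls short of it by
`(y - t * √x) ^ 2 / t`. -/
theorem quadratic_transform_eq_mul_sub {x t : ℝ} (hx : 0 ≤ x) (ht : t ≠ 0) (y : ℝ) :
    2 * y * Real.sqrt x - y ^ 2 / t = x * t - (y - t * Real.sqrt x) ^ 2 / t := by
  field_simp
  linear_combination t ^ 2 * Real.sq_sqrt hx

/-- Quadratic-transform reformulation of a completion constraint: for
nonnegative rates `X i` and positive durations `t i`, the constraint
`∑ i, X i · t i ≥ D` holds iff there exist auxiliary variables `y i` with
`∑ i, (2·(y i)·√(X i) − (y i)²/(t i)) ≥ D`. -/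
theorem completion_constraint_quadratic_transform (n : ℕ)
    (X t : Fin n → ℝ) (hX : ∀ i, 0 ≤ X i) (ht : ∀ i, 0 < t i) (D : ℝ) :
    (D ≤ ∑ i, X i * t i) ↔
      ∃ y : Fin n → ℝ,
        D ≤ ∑ i, (2 * y i * Real.sqrt (X i) - (y i) ^ 2 / t i) := by
  simp only [fun (y : Fin n → ℝ) i => quadratic_transform_eq_mul_sub (hX i) (ht i).ne' (y i)]
  constructor
  · intro h
    exact ⟨fun i => t i * Real.sqrt (X i), by simpa using h⟩
  · rintro ⟨y, hy⟩
    refine hy.trans (Finset.sum_le_sum fun i _ => sub_le_self _ ?_)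
    exact div_nonneg (sq_nonneg _) (ht i).le
end
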